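/- (Separable convex optimality criterion.) Let A be an integer m×N matrix, l, u ∈ ℤ^N finite bounds, b ∈ ℤ^m, and let f : ℝ^N → ℝ be separable convex, i.e., f(y) = Σ_{k=1}^N f_k(y_k) with each univariate f_k convex. Let x be feasible for min{f(y) : Ay = b, l ≤ y ≤ u, y ∈ ℤ^N}. Then x minimizes f over the feasible points if and only if there is no element g ∈ 𝒢(A) with l ≤ x + g ≤ u and f(x+g) < f(x). -/

import Mathlib

open Matrix

/-- The conformal (sign-compatible) partial order `x ⊑ y` on integer vectors:
`x k * y k ≥ 0` and `|x k| ≤ |y k|` for every coordinate `k`. -/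
def ConformalLe {ν : Type*} (x y : ν → ℤ) : Prop :=
  ∀ k, 0 ≤ x k * y k ∧ |x k| ≤ |y k|

/-- The Graver basis of an integer matrix `A`: the set of `⊑`-minimal elements of
`{x : A x = 0, x ≠ 0}`. -/
def GraverBasis {μ ν : Type*} [Fintype ν] (A : Matrix μ ν ℤ) : Set (ν → ℤ) :=
  {x | A.mulVec x = 0 ∧ x ≠ 0 ∧
    ∀ y, A.mulVec y = 0 → y ≠ 0 → ConformalLe y x → y = x}

/-- The `ι`-fold product of the bimatrix with blocks `A1` (first block, `r × τ`) and
`A2` (second block, `s × τ`): the first `r` rows are `(A1 A1 ⋯ A1)` and the remaining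
rows form a block-diagonal matrix with a copy of `A2` for each index in `ι`. -/
def nFold {r s : ℕ} {τ : Type*} (A1 : Matrix (Fin r) τ ℤ) (A2 : Matrix (Fin s) τ ℤ)
    (ι : Type*) [DecidableEq ι] : Matrix (Fin r ⊕ ι × Fin s) (ι × τ) ℤ :=
  Matrix.of fun i jt =>
    match i with
    | Sum.inl a => A1 a jt.2
    | Sum.inr (k, c) => if jt.1 = k then A2 c jt.2 else 0

/-- The `i`-th brick of a vector indexed by `ι × τ`. -/
def brick {ι τ : Type*} (x : ι × τ → ℤ) (i : ι) : τ → ℤ := fun j => x (i, j)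

/-- The Graver complexity of the bimatrix `(A1, A2)`: the largest number of nonzero
bricks appearing in any element of the Graver basis of any `n`-fold product. -/
noncomputable def graverComplexity {r s t : ℕ} (A1 : Matrix (Fin r) (Fin t) ℤ)
    (A2 : Matrix (Fin s) (Fin t) ℤ) : ℕ :=
  sSup {k : ℕ | ∃ (n : ℕ) (g : Fin n × Fin t → ℤ),
    g ∈ GraverBasis (nFold A1 A2 (Fin n)) ∧
    k = {i : Fin n | brick g i ≠ 0}.ncard}

/-- `Z(A)`: the set of all vectors in `ℤ^t` that are sums of at most `g(A)` elements
of the Graver basis of `A2`. -/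
noncomputable def ZSet {r s t : ℕ} (A1 : Matrix (Fin r) (Fin t) ℤ)
    (A2 : Matrix (Fin s) (Fin t) ℤ) : Set (Fin t → ℤ) :=
  {z | ∃ L : List (Fin t → ℤ), L.length ≤ graverComplexity A1 A2 ∧
    (∀ h ∈ L, h ∈ GraverBasis A2) ∧ z = L.sum}

theorem Int.abs_add_of_mul_nonneg {a b : ℤ} (h : 0 ≤ a * b) : |a + b| = |a| + |b| := by
  rw [abs_add_eq_add_abs_iff]
  exact mul_nonneg_iff.mp h

/-- The increments of a convex function are superadditive over increments of equal sign. -/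
theorem ConvexOn.add_le_add_of_mul_nonneg {φ : ℝ → ℝ} (hφ : ConvexOn ℝ Set.univ φ)
    (a : ℝ) {p q : ℝ} (hpq : 0 ≤ p * q) : φ (a + p) + φ (a + q) ≤ φ a + φ (a + (p + q)) := by
  by_cases h0 : p + q = 0
  · have hp : p = 0 := by nlinarith [sq_nonneg p]
    have hq : q = 0 := by linarith
    simp [hp, hq]
  · have hs : 0 < (p + q) ^ 2 := by positivity
    have nonneg_div : ∀ {r s : ℝ}, 0 ≤ r * s → r + s ≠ 0 → 0 ≤ r / (r + s) := by
      intro r s hrs hne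
      have : r / (r + s) = (r ^ 2 + r * s) / (r + s) ^ 2 := by field_simp
      rw [this]
      positivity
    have hp : 0 ≤ p / (p + q) := nonneg_div hpq h0
    have hq : 0 ≤ q / (p + q) := by
      rw [add_comm p q]
      exact nonneg_div (by linarith) (by rwa [add_comm])
    have hsum : p / (p + q) + q / (p + q) = 1 := by field_simp
    have h1 := hφ.2 (Set.mem_univ a) (Set.mem_univ (a + (p + q))) hq hp (by linarith)
    have h2 := hφ.2 (Set.mem_univ a) (Set.mem_univ (a + (p + q))) hp hq hsum
    have e1 : q / (p + q) * a + p / (p + q) * (a + (p + q)) = a + p := by field_simp; ring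
    have e2 : p / (p + q) * a + q / (p + q) * (a + (p + q)) = a + q := by field_simp; ring
    simp only [smul_eq_mul, e1, e2] at h1 h2
    have h3 : p / (p + q) * (φ a + φ (a + (p + q))) + q / (p + q) * (φ a + φ (a + (p + q)))
        = φ a + φ (a + (p + q)) := by rw [← add_mul, hsum, one_mul]
    linarith

namespace ConformalLe

variable {ν : Type*} {x y z : ν → ℤ}

theorem refl (x : ν → ℤ) : ConformalLe x x := fun _ => ⟨mul_self_nonneg _, le_rfl⟩

theorem trans (hxy : ConformalLe x y) (hyz : ConformalLe y z) : ConformalLe x z := by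
  intro k
  obtain ⟨h1, h2⟩ := hxy k
  obtain ⟨h3, h4⟩ := hyz k
  refine ⟨?_, h2.trans h4⟩
  by_cases hy : y k = 0
  · have hx : x k = 0 := by simpa [hy] using h2
    simp [hx]
  · have hyy : 0 < y k * y k := mul_self_pos.mpr hy
    have : 0 ≤ (y k * y k) * (x k * z k) := by nlinarith [mul_nonneg h1 h3]
    exact nonneg_of_mul_nonneg_right this hyy

theorem mul_sub_nonneg (h : ConformalLe x y) (k : ν) : 0 ≤ x k * (y k - x k) := by
  obtain ⟨h1, h2⟩ := h k
  have : |x k| * |x k| ≤ |x k| * |y k| := mul_le_mul_of_nonneg_left h2 (abs_nonneg _)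
  rw [abs_mul_abs_self, ← abs_mul, abs_of_nonneg h1] at this
  linarith

theorem abs_eq_add (h : ConformalLe x y) (k : ν) : |y k| = |x k| + |(y - x) k| := by
  rw [Pi.sub_apply, ← Int.abs_add_of_mul_nonneg (h.mul_sub_nonneg k), add_sub_cancel]

theorem sub_left (h : ConformalLe x y) : ConformalLe (y - x) y := by
  intro k
  refine ⟨?_, by linarith [h.abs_eq_add k, abs_nonneg (x k)]⟩
  have := h.mul_sub_nonneg k
  rw [Pi.sub_apply]
  nlinarith [sq_nonneg (y k - x k)]

theorem le_add_of_le_add (h : ConformalLe x y) {l a : ν → ℤ} (ha : l ≤ a) (hy : l ≤ a + y) :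
    l ≤ a + x := by
  intro k
  have h1 := ha k
  have h2 := hy k
  have h3 := h.mul_sub_nonneg k
  simp only [Pi.add_apply] at h2 ⊢
  rcases mul_nonneg_iff.mp h3 with ⟨_, _⟩ | ⟨_, _⟩ <;> linarith

theorem add_le_of_add_le (h : ConformalLe x y) {u a : ν → ℤ} (ha : a ≤ u) (hy : a + y ≤ u) :
    a + x ≤ u := by
  intro k
  have h1 := ha k
  have h2 := hy k
  have h3 := h.mul_sub_nonneg k
  simp only [Pi.add_apply] at h2 ⊢
  rcases mul_nonneg_iff.mp h3 with ⟨_, _⟩ | ⟨_, _⟩ <;> linarith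

variable [Fintype ν]

theorem sum_abs_lt (h : ConformalLe x y) (hne : x ≠ y) : ∑ k, |x k| < ∑ k, |y k| := by
  obtain ⟨k, hk⟩ := Function.ne_iff.mp hne
  refine Finset.sum_lt_sum (fun k _ => (h k).2) ⟨k, Finset.mem_univ k, ?_⟩
  have := abs_pos.mpr (sub_ne_zero.mpr hk.symm)
  have := h.abs_eq_add k
  rw [Pi.sub_apply] at this
  linarith

end ConformalLe

/-- If no element of the Graver basis conformal to `h` violates `P`, neither does the kernel
element `h`, provided `P` is preserved by sign-compatible sums. -/
theorem GraverBasis.conformal_induction {μ ν : Type*} [Fintype ν] {A : Matrix μ ν ℤ}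
    {P : (ν → ℤ) → Prop} (zero : P 0)
    (add : ∀ g h : ν → ℤ, (∀ k, 0 ≤ g k * h k) → P g → P h → P (g + h))
    (h : ν → ℤ) (hA : A.mulVec h = 0) (graver : ∀ g ∈ GraverBasis A, ConformalLe g h → P g) :
    P h := by
  induction hn : (∑ k, |h k|).toNat using Nat.strong_induction_on generalizing h with
  | _ n ih =>
    by_cases h0 : h = 0
    · exact h0 ▸ zero
    by_cases hG : h ∈ GraverBasis A
    · exact graver h hG (ConformalLe.refl h)
    obtain ⟨y, hyA, hy0, hyh, hne⟩ :
        ∃ y, A.mulVec y = 0 ∧ y ≠ 0 ∧ ConformalLe y h ∧ y ≠ h := by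
      by_contra! hcon
      exact hG ⟨hA, h0, hcon⟩
    have of_lt : ∀ z, A.mulVec z = 0 → ConformalLe z h → z ≠ h → P z := by
      intro z hzA hzh hzne
      refine ih _ ?_ z hzA (fun g hg hgz => graver g hg (hgz.trans hzh)) rfl
      have := hzh.sum_abs_lt hzne
      have : 0 ≤ ∑ k, |z k| := Finset.sum_nonneg fun k _ => abs_nonneg _
      omega
    have := add y (h - y) hyh.mul_sub_nonneg (of_lt y hyA hyh hne)
      (of_lt (h - y) (by rw [Matrix.mulVec_sub, hA, hyA, sub_zero]) hyh.sub_left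
        (by simpa using hy0))
    rwa [add_sub_cancel] at this

/-- **separable convex optimality criterion.** Let `f(y) = ∑ₖ fₖ(yₖ)`
with each univariate `fₖ` convex, and let `x` be feasible for
`min{f(y) : Ay = b, l ≤ y ≤ u, y ∈ ℤ^N}`. Then `x` minimizes `f` over the feasible
points if and only if there is no `g ∈ 𝒢(A)` with `l ≤ x + g ≤ u` and
`f(x+g) < f(x)`. -/
theorem separable_convex_optimality_criterion {m N : ℕ}
    (A : Matrix (Fin m) (Fin N) ℤ) (l u : Fin N → ℤ) (b : Fin m → ℤ)
    (f : (Fin N → ℝ) → ℝ) (fk : Fin N → ℝ → ℝ)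
    (hconv : ∀ k, ConvexOn ℝ Set.univ (fk k))
    (hf : ∀ y, f y = ∑ k, fk k (y k))
    (x : Fin N → ℤ) (hxb : A.mulVec x = b) (hxl : l ≤ x) (hxu : x ≤ u) :
    (∀ y : Fin N → ℤ, A.mulVec y = b → l ≤ y → y ≤ u →
        f (fun k => (x k : ℝ)) ≤ f (fun k => (y k : ℝ))) ↔
      ¬∃ g ∈ GraverBasis A, l ≤ x + g ∧ x + g ≤ u ∧
        f (fun k => ((x + g) k : ℝ)) < f (fun k => (x k : ℝ)) := by
  constructor
  · rintro hmin ⟨g, ⟨hgA, -, -⟩, hl, hu, hlt⟩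
    exact (hmin (x + g) (by rw [Matrix.mulVec_add, hxb, hgA, add_zero]) hl hu).not_gt hlt
  · intro hno y hyb hyl hyu
    have hxy : x + (y - x) = y := add_sub_cancel x y
    suffices h : f (fun k => (x k : ℝ)) ≤ f (fun k => ((x + (y - x)) k : ℝ)) by rwa [hxy] at h
    refine GraverBasis.conformal_induction (A := A)
      (P := fun h => f (fun k => (x k : ℝ)) ≤ f (fun k => ((x + h) k : ℝ)))
      (by simp) ?_ (y - x) (by rw [Matrix.mulVec_sub, hyb, hxb, sub_self]) ?_
    · intro g h hgh hg hh
      have hsuper : f (fun k => ((x + g) k : ℝ)) + f (fun k => ((x + h) k : ℝ)) ≤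
          f (fun k => (x k : ℝ)) + f (fun k => ((x + (g + h)) k : ℝ)) := by
        simp only [hf, ← Finset.sum_add_distrib]
        refine Finset.sum_le_sum fun k _ => ?_
        have hk : (0 : ℝ) ≤ g k * h k := mod_cast hgh k
        simpa using (hconv k).add_le_add_of_mul_nonneg (x k) hk
      linarith
    · intro g hg hgy
      by_contra! hlt
      exact hno ⟨g, hg, hgy.le_add_of_le_add hxl (hxy.symm ▸ hyl),
        hgy.add_le_of_add_le hxu (hxy.symm ▸ hyu), hlt⟩
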